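/- (Scaled-service analogue of Lemma 3.6, single arrival step.) Let β ∈ (0,1]. Let L, U, L^β, U^β ∈ ℝ^c be workload vectors with L(k) ≤ U(k), L^β(k) ≤ U^β(k) and U^β(k) ≤ U(k) for all k. Suppose that: (i) if L(1) = U(1) then U(1) = 0; and (ii) C(L^β, U^β) ≤ C(L, U). Then for any service duration S > 0, after an arrival bringing service S to the (L,U) system and service βS to the (L^β,U^β) system, C(arr_{βS}(L^β), arr_{βS}(U^β)) ≤ C(arr_S(L), arr_S(U)). -/

import Mathlib

open scoped Classical

noncomputable section

/-- The `k`-th coordinate (0-based) of a vector in `ℝ^n`, defaulting to 0 out of range. -/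
def coord {n : ℕ} (V : Fin n → ℝ) (k : ℕ) : ℝ :=
  if h : k < n then V ⟨k, h⟩ else 0

/-- A workload vector: coordinates nonnegative and in increasing order. -/
def IsWorkload {n : ℕ} (V : Fin n → ℝ) : Prop :=
  Monotone V ∧ ∀ i, 0 ≤ V i

/-- Add the service duration `S` to the minimal (first) coordinate. -/
def bump {n : ℕ} (S : ℝ) (V : Fin n → ℝ) : Fin n → ℝ :=
  fun i => if (i : ℕ) = 0 then V i + S else V i

/-- The arrival step: increasing rearrangement of the vector obtained from `V`
by replacing its minimal coordinate `V(1)` by `V(1) + S`. -/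
def arr {n : ℕ} (S : ℝ) (V : Fin n → ℝ) : Fin n → ℝ :=
  bump S V ∘ Tuple.sort (bump S V)

/-- The decay step: each coordinate decreases by `t`, truncated at 0. -/
def dec {n : ℕ} (t : ℝ) (V : Fin n → ℝ) : Fin n → ℝ :=
  fun i => max (V i - t) 0

/-- The Kiefer-Wolfowitz one-step update with service `S` and elapsed time `t`. -/
def step {n : ℕ} (S t : ℝ) (V : Fin n → ℝ) : Fin n → ℝ :=
  dec t (arr S V)

/-- `kU S V` (1-based): the least `k ∈ {1,…,n−1}` with `V(1)+S ≤ V(k+1)`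
(0-based: `coord V 0 + S ≤ coord V k`), and `n` if there is no such `k`. -/
def kU {n : ℕ} (S : ℝ) (V : Fin n → ℝ) : ℕ :=
  sInf ({k : ℕ | 1 ≤ k ∧ k < n ∧ coord V 0 + S ≤ coord V k} ∪ {n})

/-- `OrdDom V W` (i.e. `V ⊴ W`): each of the `c` busiest servers of `V ∈ ℝ^{c+m}`
has no more work than the corresponding server of `W ∈ ℝ^c`. -/
def OrdDom {c m : ℕ} (V : Fin (c + m) → ℝ) (W : Fin c → ℝ) : Prop :=
  ∀ k : ℕ, k < c → coord V (k + m) ≤ coord W k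

/-- The time-to-coalescence `C(L,U)`: equal to `U(n)` for
`n = max{k : L(k) ≠ U(k)}` when `L ≠ U`, and `0` when `L = U`. -/
def coalTime {n : ℕ} (L U : Fin n → ℝ) : ℝ :=
  if L = U then 0 else coord U (sSup {k : ℕ | k < n ∧ coord L k ≠ coord U k})

end

/-- The number of coordinates of `V` that are at least `x`. -/
noncomputable def countGE {n : ℕ} (x : ℝ) (V : Fin n → ℝ) : ℕ :=
  ∑ i, if x ≤ V i then 1 else 0

theorem countGE_eq_card {n : ℕ} (x : ℝ) (V : Fin n → ℝ) :
    countGE x V = (Finset.univ.filter fun i => x ≤ V i).card := by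
  simp [countGE]

theorem countGE_mono {n : ℕ} (x : ℝ) {V W : Fin n → ℝ} (h : ∀ i, V i ≤ W i) :
    countGE x V ≤ countGE x W := by
  rw [countGE_eq_card, countGE_eq_card]
  exact Finset.card_le_card
    (Finset.monotone_filter_right _ fun i _ hi => le_trans hi (h i))

theorem le_apply_iff_le_countGE {n : ℕ} {V : Fin n → ℝ} (hV : Monotone V) (x : ℝ) (i : Fin n) :
    x ≤ V i ↔ n - (i : ℕ) ≤ countGE x V := by
  rw [countGE_eq_card]
  constructor
  · intro h
    rw [← Fin.card_Ici]
    refine Finset.card_le_card fun j hj => ?_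
    simpa using h.trans (hV (Finset.mem_Ici.mp hj))
  · intro h
    by_contra! hlt
    have hsub : (Finset.univ.filter fun j => x ≤ V j) ⊆ Finset.Ioi i := by
      intro j hj
      rw [Finset.mem_Ioi]
      by_contra! hji
      exact absurd ((Finset.mem_filter.mp hj).2.trans (hV hji)) (not_le.mpr hlt)
    have hcard := Finset.card_le_card hsub
    rw [Fin.card_Ioi] at hcard
    have := i.isLt
    omega

theorem coord_val {n : ℕ} (V : Fin n → ℝ) (i : Fin n) : coord V i = V i := by
  simp [coord]

theorem coalTime_le_iff {n : ℕ} {L U : Fin n → ℝ} (hU : Monotone U) {T : ℝ} (hT : 0 ≤ T) :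
    coalTime L U ≤ T ↔ ∀ i, L i ≠ U i → U i ≤ T := by
  unfold coalTime
  split_ifs with h
  · simp [h, hT]
  · set K : Set ℕ := {k : ℕ | k < n ∧ coord L k ≠ coord U k} with hK
    have hbdd : BddAbove K := ⟨n, fun k hk => hk.1.le⟩
    have hmem : ∀ i : Fin n, L i ≠ U i → (i : ℕ) ∈ K := fun i hi =>
      ⟨i.isLt, by rwa [coord_val, coord_val]⟩
    obtain ⟨i₀, hi₀⟩ := Function.ne_iff.mp h
    obtain ⟨hlt, hne⟩ : sSup K ∈ K := Nat.sSup_mem ⟨_, hmem i₀ hi₀⟩ hbdd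
    have hval (V : Fin n → ℝ) : coord V (sSup K) = V ⟨sSup K, hlt⟩ := coord_val V ⟨sSup K, hlt⟩
    rw [hval, hval] at hne
    rw [hval]
    exact ⟨fun hle i hi => (hU (Fin.le_def.mpr (le_csSup hbdd (hmem i hi)))).trans hle,
      fun hall => hall _ hne⟩

theorem coalTime_nonneg {n : ℕ} {L U : Fin n → ℝ} (hU : ∀ i, 0 ≤ U i) : 0 ≤ coalTime L U := by
  unfold coalTime coord
  split_ifs
  exacts [le_rfl, hU _, le_rfl]

theorem coalTime_le_iff_countGE {n : ℕ} {L U : Fin n → ℝ} (hL : Monotone L) (hU : Monotone U)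
    (hLU : ∀ i, L i ≤ U i) {T : ℝ} (hT : 0 ≤ T) :
    coalTime L U ≤ T ↔ ∀ x, T < x → countGE x U ≤ countGE x L := by
  rw [coalTime_le_iff hU hT]
  constructor
  · intro h x hx
    rw [countGE_eq_card, countGE_eq_card]
    refine Finset.card_le_card (Finset.monotone_filter_right _ fun i _ hi => ?_)
    by_cases hne : L i = U i
    · exact hi.trans hne.ge
    · exact absurd (h i hne) (not_le.mpr (hx.trans_le hi))
  · intro h i hne
    by_contra! hlt
    exact hne ((hLU i).antisymm ((le_apply_iff_le_countGE hL _ i).mpr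
      (((le_apply_iff_le_countGE hU _ i).mp le_rfl).trans (h _ hlt))))

theorem arr_monotone {n : ℕ} (S : ℝ) (V : Fin n → ℝ) : Monotone (arr S V) :=
  Tuple.monotone_sort _

theorem countGE_arr {n : ℕ} (x S : ℝ) (V : Fin n → ℝ) :
    countGE x (arr S V) = countGE x (bump S V) :=
  Equiv.sum_comp (Tuple.sort (bump S V)) fun i => if x ≤ bump S V i then 1 else 0

theorem bump_le_bump {n : ℕ} (S : ℝ) {V W : Fin n → ℝ} (h : ∀ i, V i ≤ W i) (i : Fin n) :
    bump S V i ≤ bump S W i := by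
  unfold bump
  split_ifs
  exacts [by linarith [h i], h i]

theorem arr_le_arr {n : ℕ} (S : ℝ) {V W : Fin n → ℝ} (h : ∀ i, V i ≤ W i) (i : Fin n) :
    arr S V i ≤ arr S W i := by
  rw [le_apply_iff_le_countGE (arr_monotone S W), countGE_arr]
  refine le_trans ?_ (countGE_mono _ (bump_le_bump S h))
  rw [← countGE_arr, ← le_apply_iff_le_countGE (arr_monotone S V)]

theorem arr_nonneg {n : ℕ} {S : ℝ} (hS : 0 ≤ S) {V : Fin n → ℝ} (hV : ∀ i, 0 ≤ V i)
    (i : Fin n) : 0 ≤ arr S V i := by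
  simp only [arr, bump, Function.comp_apply]
  split_ifs
  exacts [add_nonneg (hV _) hS, hV _]

theorem countGE_arr_add {m : ℕ} (x S : ℝ) (V : Fin (m + 1) → ℝ) :
    countGE x (arr S V) + (if x ≤ V 0 then 1 else 0) =
      countGE x V + (if x ≤ V 0 + S then 1 else 0) := by
  rw [countGE_arr]
  simp only [countGE, Fin.sum_univ_succ, bump, Fin.val_zero, Fin.val_succ, if_true,
    Nat.succ_ne_zero, if_false]
  ring

theorem coalTime_arr_le {m : ℕ} {L U : Fin (m + 1) → ℝ} (hL : Monotone L) (hU : Monotone U)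
    (hLU : ∀ i, L i ≤ U i) {S T : ℝ} (hS : 0 ≤ S) (hT : 0 ≤ T) (hC : coalTime L U ≤ T)
    (h0 : L 0 ≠ U 0 → U 0 + S ≤ T) : coalTime (arr S L) (arr S U) ≤ T := by
  rw [coalTime_le_iff_countGE (arr_monotone S L) (arr_monotone S U) (arr_le_arr S hLU) hT]
  intro x hx
  have hcount := (coalTime_le_iff_countGE hL hU hLU hT).mp hC x hx
  have hcL := countGE_arr_add x S L
  have hcU := countGE_arr_add x S U
  by_cases h : L 0 = U 0
  · rw [h] at hcL
    omega
  · have hle := h0 h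
    rw [if_neg (by linarith [hLU 0]), if_neg (by linarith [hLU 0])] at hcL
    rw [if_neg (by linarith), if_neg (by linarith)] at hcU
    omega

theorem add_le_coalTime_arr {m : ℕ} {L U : Fin (m + 1) → ℝ} (hLU : ∀ i, L i ≤ U i)
    (hU0 : ∀ i, 0 ≤ U i) {S : ℝ} (hS : 0 < S) (h0 : L 0 ≠ U 0) :
    U 0 + S ≤ coalTime (arr S L) (arr S U) := by
  by_contra! hlt
  have hcount := (coalTime_le_iff_countGE (arr_monotone S L) (arr_monotone S U)
    (arr_le_arr S hLU) (coalTime_nonneg (arr_nonneg hS.le hU0))).mp le_rfl _ hlt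
  have hmono := countGE_mono (U 0 + S) hLU
  have hlt0 := lt_of_le_of_ne (hLU 0) h0
  have hcL := countGE_arr_add (U 0 + S) S L
  have hcU := countGE_arr_add (U 0 + S) S U
  rw [if_neg (by linarith), if_neg (by linarith)] at hcL
  rw [if_neg (by linarith), if_pos le_rfl] at hcU
  omega

theorem coalTime_le_coalTime_arr {m : ℕ} {L U : Fin (m + 1) → ℝ} (hL : Monotone L)
    (hU : Monotone U) (hLU : ∀ i, L i ≤ U i) (hU0 : ∀ i, 0 ≤ U i) {S : ℝ} (hS : 0 < S) :
    coalTime L U ≤ coalTime (arr S L) (arr S U) := by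
  have hT : 0 ≤ coalTime (arr S L) (arr S U) := coalTime_nonneg (arr_nonneg hS.le hU0)
  rw [coalTime_le_iff_countGE hL hU hLU hT]
  intro x hx
  have hcount := (coalTime_le_iff_countGE (arr_monotone S L) (arr_monotone S U)
    (arr_le_arr S hLU) hT).mp le_rfl x hx
  have hcL := countGE_arr_add x S L
  have hcU := countGE_arr_add x S U
  by_cases h : L 0 = U 0
  · rw [h] at hcL
    omega
  · have hle := add_le_coalTime_arr hLU hU0 hS h
    rw [if_neg (by linarith [hLU 0]), if_neg (by linarith [hLU 0])] at hcL
    rw [if_neg (by linarith), if_neg (by linarith)] at hcU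
    omega

/-- scaled-service analogue of Lemma 3.6, single arrival step. -/
theorem stmt14 {c : ℕ} (hc : 1 ≤ c) (β : ℝ) (hβ0 : 0 < β) (hβ1 : β ≤ 1)
    (L U Lb Ub : Fin c → ℝ)
    (hL : IsWorkload L) (hU : IsWorkload U)
    (hLb : IsWorkload Lb) (hUb : IsWorkload Ub)
    (hLU : ∀ k, L k ≤ U k) (hLUb : ∀ k, Lb k ≤ Ub k) (hUbU : ∀ k, Ub k ≤ U k)
    (h1 : coord L 0 = coord U 0 → coord U 0 = 0)
    (h2 : coalTime Lb Ub ≤ coalTime L U)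
    (S : ℝ) (hS : 0 < S) :
    coalTime (arr (β * S) Lb) (arr (β * S) Ub) ≤ coalTime (arr S L) (arr S U) := by
  obtain ⟨m, rfl⟩ : ∃ m, c = m + 1 := ⟨c - 1, by omega⟩
  have hcoord (V : Fin (m + 1) → ℝ) : coord V 0 = V 0 := coord_val V 0
  rw [hcoord, hcoord] at h1
  refine coalTime_arr_le hLb.1 hUb.1 hLUb (mul_pos hβ0 hS).le
    (coalTime_nonneg (arr_nonneg hS.le hU.2))
    (h2.trans (coalTime_le_coalTime_arr hL.1 hU.1 hLU hU.2 hS)) fun hne => ?_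
  have hLU0 : L 0 ≠ U 0 := fun h => by
    have hUb0 := hUbU 0
    rw [h1 h] at hUb0
    exact hne ((hLUb 0).antisymm (hUb0.trans (hLb.2 0)))
  have hle := add_le_coalTime_arr hLU hU.2 hS hLU0
  have hβS : β * S ≤ S := mul_le_of_le_one_left hS.le hβ1
  linarith [hUbU 0]
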